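/- The Nash optimum 2-approximates the utilitarian social welfare: for every profile x ∈ [0,1]^n, every Nash optimum y* for x, and every y ∈ [0,1], USW(y, x) ≤ 2·USW(y*, x). -/

import Mathlib

open Set

noncomputable section

/-- Utility of an agent at location `z` when the facility is at `y`. -/
def util (y z : ℝ) : ℝ := 1 - |y - z|

/-- Nash welfare: product of agents' utilities. -/
def nash {n : ℕ} (y : ℝ) (x : Fin n → ℝ) : ℝ := ∏ i, util y (x i)

/-- `y` is a Nash optimum for the profile `x`. -/
def isNashOpt {n : ℕ} (x : Fin n → ℝ) (y : ℝ) : Prop :=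
  y ∈ Set.Icc (0 : ℝ) 1 ∧ ∀ z ∈ Set.Icc (0 : ℝ) 1, nash z x ≤ nash y x

/-- Utilitarian social welfare: sum of agents' utilities. -/
def usw {n : ℕ} (y : ℝ) (x : Fin n → ℝ) : ℝ := ∑ i, util y (x i)

lemma util_nonneg {y z : ℝ} (hy : y ∈ Set.Icc (0 : ℝ) 1) (hz : z ∈ Set.Icc (0 : ℝ) 1) :
    0 ≤ util y z := by
  have := abs_sub_le_of_le_of_le hy.1 hy.2 hz.1 hz.2
  unfold util
  linarith

lemma util_pos {y z : ℝ} (hy : y ∈ Set.Ioo (0 : ℝ) 1) (hz : z ∈ Set.Icc (0 : ℝ) 1) :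
    0 < util y z := by
  have : |y - z| < 1 := abs_sub_lt_iff.2 ⟨by linarith [hy.2, hz.1], by linarith [hy.1, hz.2]⟩
  unfold util
  linarith

lemma util_reflect (y z : ℝ) : util (1 - y) (1 - z) = util y z := by
  rw [util, util, sub_sub_sub_cancel_left, abs_sub_comm]

lemma util_sub_two_mul_util_mul_le_of_le {a b z : ℝ} (ha : 0 ≤ a) (hab : a ≤ b) (hb : b ≤ 1)
    (hz : z ∈ Set.Icc (0 : ℝ) 1) :
    (util b z - 2 * util a z) * util ((a + b) / 2) z ≤
      2 * (b - a) * (util ((a + b) / 2) z - util a z) := by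
  obtain ⟨hz0, hz1⟩ := hz
  obtain ⟨t, rfl⟩ : ∃ t, b = a + 2 * t := ⟨(b - a) / 2, by ring⟩
  have hm : (a + (a + 2 * t)) / 2 = a + t := by ring
  have ht : 0 ≤ t := by linarith
  rw [hm]
  unfold util
  obtain ⟨p, rfl⟩ : ∃ p, z = a + p := ⟨z - a, by ring⟩
  have e1 : a + 2 * t - (a + p) = 2 * t - p := by ring
  have e2 : a + t - (a + p) = t - p := by ring
  have e3 : a - (a + p) = -p := by ring
  rw [e1, e2, e3, abs_neg]
  rcases le_total p 0 with hp | hp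
  · rw [abs_of_nonpos hp, abs_of_nonneg (by linarith : 0 ≤ 2 * t - p),
      abs_of_nonneg (by linarith : 0 ≤ t - p)]
    nlinarith [mul_nonneg (by linarith : 0 ≤ 1 + p - 2 * t) ht,
      mul_nonneg (by linarith : 0 ≤ 1 + p - 2 * t) (by linarith : 0 ≤ 1 + p - 2 * t)]
  rw [abs_of_nonneg hp]
  rcases le_total p t with hpt | hpt
  · rw [abs_of_nonneg (by linarith : 0 ≤ 2 * t - p), abs_of_nonneg (by linarith : 0 ≤ t - p)]
    have h2 : 0 ≤ 1 - 2 * t := by linarith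
    nlinarith [mul_nonneg hp (by linarith : 0 ≤ t - p), mul_nonneg h2 ht, mul_nonneg h2 hp,
      mul_nonneg h2 (by linarith : 0 ≤ t - p), mul_nonneg ht hp]
  have hV : 0 ≤ 1 - p + t := by linarith
  rw [abs_of_nonpos (by linarith : t - p ≤ 0)]
  have hU : 1 - |2 * t - p| ≤ 1 - p + 2 * t := by linarith [neg_abs_le (2 * t - p)]
  nlinarith [mul_le_mul_of_nonneg_right hU hV, sq_nonneg (1 - p - t / 2), sq_nonneg t]

lemma util_sub_two_mul_util_mul_le {a b z : ℝ} (ha : a ∈ Set.Icc (0 : ℝ) 1)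
    (hb : b ∈ Set.Icc (0 : ℝ) 1) (hz : z ∈ Set.Icc (0 : ℝ) 1) :
    (util b z - 2 * util a z) * util ((a + b) / 2) z ≤
      2 * |b - a| * (util ((a + b) / 2) z - util a z) := by
  rcases le_total a b with hab | hab
  · rw [abs_of_nonneg (sub_nonneg.2 hab)]
    exact util_sub_two_mul_util_mul_le_of_le ha.1 hab hb.2 hz
  · have h := util_sub_two_mul_util_mul_le_of_le (a := 1 - a) (b := 1 - b) (z := 1 - z)
      (by linarith [ha.2]) (by linarith) (by linarith [hb.1])
      ⟨by linarith [hz.2], by linarith [hz.1]⟩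
    have hm : (1 - a + (1 - b)) / 2 = 1 - (a + b) / 2 := by ring
    rw [hm, util_reflect, util_reflect, util_reflect, sub_sub_sub_cancel_left] at h
    rwa [abs_of_nonpos (sub_nonpos.2 hab), neg_sub]

lemma util_pos_of_isNashOpt {n : ℕ} {x : Fin n → ℝ} (hx : ∀ i, x i ∈ Set.Icc (0 : ℝ) 1)
    {y : ℝ} (hy : isNashOpt x y) (i : Fin n) : 0 < util y (x i) := by
  have hhalf : 0 < nash (1 / 2) x :=
    Finset.prod_pos fun j _ => util_pos ⟨by norm_num, by norm_num⟩ (hx j)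
  have hpos : nash y x ≠ 0 := (hhalf.trans_le (hy.2 _ ⟨by norm_num, by norm_num⟩)).ne'
  exact (util_nonneg hy.1 (hx i)).lt_of_ne'
    (Finset.prod_ne_zero_iff.1 hpos i (Finset.mem_univ i))

lemma sum_one_sub_div_nonpos_of_prod_le {ι : Type*} (s : Finset ι) {u v : ι → ℝ}
    (hu : ∀ i ∈ s, 0 < u i) (hv : ∀ i ∈ s, 0 < v i) (h : ∏ i ∈ s, v i ≤ ∏ i ∈ s, u i) :
    ∑ i ∈ s, (1 - u i / v i) ≤ 0 := by
  calc ∑ i ∈ s, (1 - u i / v i) ≤ ∑ i ∈ s, Real.log (v i / u i) := by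
        refine Finset.sum_le_sum fun i hi => ?_
        simpa using Real.one_sub_inv_le_log_of_pos (div_pos (hv i hi) (hu i hi))
    _ = Real.log ((∏ i ∈ s, v i) / ∏ i ∈ s, u i) := by
        rw [← Finset.prod_div_distrib, Real.log_prod]
        exact fun i hi => (div_pos (hv i hi) (hu i hi)).ne'
    _ ≤ 0 := Real.log_nonpos
        (div_nonneg (Finset.prod_nonneg fun i hi => (hv i hi).le)
          (Finset.prod_nonneg fun i hi => (hu i hi).le))
        (div_le_one_of_le₀ h (Finset.prod_nonneg fun i hi => (hu i hi).le))

theorem nashFL_utilitarian_approx (n : ℕ) (x : Fin n → ℝ)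
    (hx : ∀ i, x i ∈ Set.Icc (0 : ℝ) 1)
    (ystar : ℝ) (hy : isNashOpt x ystar) :
    ∀ y ∈ Set.Icc (0 : ℝ) 1, usw y x ≤ 2 * usw ystar x := by
  intro y hy'
  obtain rfl | hne := eq_or_ne y ystar
  · have : 0 ≤ usw y x := Finset.sum_nonneg fun i _ => util_nonneg hy' (hx i)
    linarith
  have hm : (ystar + y) / 2 ∈ Set.Ioo (0 : ℝ) 1 := by
    obtain ⟨h0, h1⟩ := hy.1
    obtain ⟨h0', h1'⟩ := hy'
    rcases hne.lt_or_gt with h | h <;> constructor <;> linarith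
  have hv : ∀ i, 0 < util ((ystar + y) / 2) (x i) := fun i => util_pos hm (hx i)
  have hsum := sum_one_sub_div_nonpos_of_prod_le Finset.univ
    (fun i _ => util_pos_of_isNashOpt hx hy i) (fun i _ => hv i)
    (hy.2 _ (Set.Ioo_subset_Icc_self hm))
  have hle : ∑ i, (util y (x i) - 2 * util ystar (x i)) ≤
      ∑ i, 2 * |y - ystar| * (1 - util ystar (x i) / util ((ystar + y) / 2) (x i)) := by
    refine Finset.sum_le_sum fun i _ => ?_
    rw [one_sub_div (hv i).ne', ← mul_div_assoc, le_div_iff₀ (hv i)]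
    exact util_sub_two_mul_util_mul_le hy.1 hy' (hx i)
  rw [Finset.sum_sub_distrib, ← Finset.mul_sum, ← Finset.mul_sum] at hle
  have := mul_nonpos_of_nonneg_of_nonpos (by positivity : 0 ≤ 2 * |y - ystar|) hsum
  unfold usw
  linarith
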